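/- arXiv:math/0305140 — 4 statements merged into one kernel-verified Lean document; each statement's English description precedes it below -/
import Mathlib

section
/- Let E be an n-dimensional real inner product space with n ≥ 3 and orthonormal basis (e₁,…,eₙ), S a finite-dimensional real inner product space, and c : E → (S →ₗ S) a linear map satisfying the Clifford relation c(v)∘c(w) + c(w)∘c(v) = −2⟪v,w⟫·id for all v,w ∈ E and skew-adjointness ⟪c(v)x, y⟫ = −⟪x, c(v)y⟫ for all v ∈ E, x,y ∈ S. Let ψ' : E → S be a linear map, set Dψ' := Σᵢ c(eᵢ)(ψ'(eᵢ)), let θ ∈ E with ‖θ‖ = 1, and for X ∈ E define T_X := ψ'(X) + (1/(n−1))·c(X)(Dψ') − (1/(n−1))·⟪X,θ⟫·c(θ)(Dψ') − ⟪X,θ⟫·ψ'(θ). Then Σᵢ ‖T_{eᵢ}‖² = Σᵢ ‖ψ'(eᵢ)‖² − (1/(n−1))·‖Dψ'‖² − ‖ψ'(θ)‖² + (2/(n−1))·⟪Dψ', c(θ)(ψ'(θ))⟫. -/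
open scoped InnerProductSpace
open Finset

/-- Removing the `θ`-component of a linear map, for a unit vector `θ`, lowers its squared
Hilbert-Schmidt norm by `‖L θ‖ ^ 2`. -/
theorem OrthonormalBasis.sum_sq_norm_sub_inner_smul {ι E S : Type*} [Fintype ι]
    [NormedAddCommGroup E] [InnerProductSpace ℝ E] [NormedAddCommGroup S] [InnerProductSpace ℝ S]
    (e : OrthonormalBasis ι ℝ E) (L : E →ₗ[ℝ] S) {θ : E} (hθ : ‖θ‖ = 1) :
    ∑ i, ‖L (e i) - ⟪e i, θ⟫_ℝ • L θ‖ ^ 2 = ∑ i, ‖L (e i)‖ ^ 2 - ‖L θ‖ ^ 2 := by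
  have hL : ∑ i, ⟪e i, θ⟫_ℝ • L (e i) = L θ := by
    conv_rhs => rw [← e.sum_repr' θ]
    simp
  have hsq : ∑ i, ⟪e i, θ⟫_ℝ ^ 2 = 1 := by
    simpa [hθ] using e.sum_sq_norm_inner_right θ
  have hcross : ∑ i, ⟪e i, θ⟫_ℝ * ⟪L (e i), L θ⟫_ℝ = ‖L θ‖ ^ 2 := by
    rw [← real_inner_self_eq_norm_sq]
    conv_rhs => rw [← hL, sum_inner, hL]
    simp [real_inner_smul_left]
  calc ∑ i, ‖L (e i) - ⟪e i, θ⟫_ℝ • L θ‖ ^ 2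
      = ∑ i, (‖L (e i)‖ ^ 2 - 2 * (⟪e i, θ⟫_ℝ * ⟪L (e i), L θ⟫_ℝ)
          + ⟪e i, θ⟫_ℝ ^ 2 * ‖L θ‖ ^ 2) := by
        refine sum_congr rfl fun i _ => ?_
        rw [norm_sub_sq_real, real_inner_smul_right, norm_smul, mul_pow, Real.norm_eq_abs, sq_abs]
    _ = ∑ i, ‖L (e i)‖ ^ 2 - ‖L θ‖ ^ 2 := by
        rw [sum_add_distrib, sum_sub_distrib, ← mul_sum, ← sum_mul, hcross, hsq]
        ring

/-- Skew-adjoint Clifford multiplication by `v` scales norms by `‖v‖`. -/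
theorem norm_sq_clifford_apply {E S : Type*} [NormedAddCommGroup E] [InnerProductSpace ℝ E]
    [NormedAddCommGroup S] [InnerProductSpace ℝ S] {c : E →ₗ[ℝ] S →ₗ[ℝ] S}
    (hclifford : ∀ v w : E, c v ∘ₗ c w + c w ∘ₗ c v = (-2 * ⟪v, w⟫_ℝ) • LinearMap.id)
    (hskew : ∀ (v : E) (x y : S), ⟪c v x, y⟫_ℝ = -⟪x, c v y⟫_ℝ) (v : E) (x : S) :
    ‖c v x‖ ^ 2 = ‖v‖ ^ 2 * ‖x‖ ^ 2 := by
  have h := congrArg (fun y => ⟪x, y⟫_ℝ) (LinearMap.congr_fun (hclifford v v) x)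
  simp only [LinearMap.add_apply, LinearMap.comp_apply, LinearMap.smul_apply, LinearMap.id_apply,
    inner_add_right, real_inner_smul_right, real_inner_self_eq_norm_sq] at h
  rw [← real_inner_self_eq_norm_sq (c v x), hskew]
  linarith

/-- Pointwise squared-norm identity (equation (5) of the paper) for the twistor-like operator
`T_X Ψ = ∇_X Ψ + (1/(n-1)) X·DΨ − (1/(n-1)) ⟨X,θ⟩ θ·DΨ − ⟨X,θ⟩ ∇_θ Ψ`. -/
theorem twistor_norm_identity
    {E S : Type*} [NormedAddCommGroup E] [InnerProductSpace ℝ E]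
    [NormedAddCommGroup S] [InnerProductSpace ℝ S] [FiniteDimensional ℝ S]
    (n : ℕ) (hn : 3 ≤ n) (e : OrthonormalBasis (Fin n) ℝ E)
    (c : E →ₗ[ℝ] S →ₗ[ℝ] S)
    (hclifford : ∀ v w : E, c v ∘ₗ c w + c w ∘ₗ c v = (-2 * ⟪v, w⟫_ℝ) • LinearMap.id)
    (hskew : ∀ (v : E) (x y : S), ⟪c v x, y⟫_ℝ = -⟪x, c v y⟫_ℝ)
    (ψ' : E →ₗ[ℝ] S) (Dψ' : S) (hD : Dψ' = ∑ i, c (e i) (ψ' (e i)))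
    (θ : E) (hθ : ‖θ‖ = 1)
    (T : E → S)
    (hT : ∀ X : E, T X = ψ' X + ((n : ℝ) - 1)⁻¹ • c X Dψ'
        - (((n : ℝ) - 1)⁻¹ * ⟪X, θ⟫_ℝ) • c θ Dψ' - ⟪X, θ⟫_ℝ • ψ' θ) :
    ∑ i, ‖T (e i)‖ ^ 2
      = ∑ i, ‖ψ' (e i)‖ ^ 2 - ((n : ℝ) - 1)⁻¹ * ‖Dψ'‖ ^ 2 - ‖ψ' θ‖ ^ 2
        + (2 / ((n : ℝ) - 1)) * ⟪Dψ', c θ (ψ' θ)⟫_ℝ := by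
  have hn' : (n : ℝ) - 1 ≠ 0 := by
    have : (3 : ℝ) ≤ n := by exact_mod_cast hn
    linarith
  have hc := norm_sq_clifford_apply hclifford hskew
  set a : ℝ := ((n : ℝ) - 1)⁻¹ with ha
  have han : a * ((n : ℝ) - 1) = 1 := inv_mul_cancel₀ hn'
  let L : E →ₗ[ℝ] S := ψ' + a • c.flip Dψ'
  have hL : ∀ X, L X = ψ' X + a • c X Dψ' := fun X => rfl
  have hTL : ∀ X, T X = L X - ⟪X, θ⟫_ℝ • L θ := by
    intro X
    rw [hT, hL, hL]
    module
  have hnorm : ∀ X, ‖L X‖ ^ 2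
      = ‖ψ' X‖ ^ 2 - 2 * a * ⟪c X (ψ' X), Dψ'⟫_ℝ + a ^ 2 * (‖X‖ ^ 2 * ‖Dψ'‖ ^ 2) := by
    intro X
    rw [hL, norm_add_sq_real, real_inner_smul_right, norm_smul, mul_pow, hc, hskew,
      Real.norm_eq_abs, sq_abs]
    ring
  have hsum : ∑ i, ‖L (e i)‖ ^ 2
      = ∑ i, ‖ψ' (e i)‖ ^ 2 - 2 * a * ‖Dψ'‖ ^ 2 + n * (a ^ 2 * ‖Dψ'‖ ^ 2) := by
    have hdirac : ∑ i, ⟪c (e i) (ψ' (e i)), Dψ'⟫_ℝ = ‖Dψ'‖ ^ 2 := by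
      rw [← sum_inner, ← hD, real_inner_self_eq_norm_sq]
    simp only [hnorm, sum_add_distrib, sum_sub_distrib, ← mul_sum, hdirac]
    simp
    ring
  simp only [hTL]
  rw [e.sum_sq_norm_sub_inner_smul L hθ, hsum, hnorm θ, hθ, real_inner_comm, div_eq_mul_inv, ← ha]
  linear_combination a * ‖Dψ'‖ ^ 2 * han
end

section
/- Let E be an n-dimensional real inner product space with orthonormal basis (e₁,…,eₙ), S a finite-dimensional real inner product space, and c : E → (S →ₗ S) a linear map satisfying the Clifford relation c(v)∘c(w) + c(w)∘c(v) = −2⟪v,w⟫·id for all v,w ∈ E. Let A : E → E be a symmetric linear endomorphism with trace A = 0, let θ ∈ E, let ψ ∈ S, and let ψ' : E → S be a linear map with Dψ' := Σᵢ c(eᵢ)(ψ'(eᵢ)). Then Σᵢ c(eᵢ)( c(A eᵢ)(ψ) + c(θ)(ψ'(eᵢ)) ) = −c(θ)(Dψ') − 2·ψ'(θ). -/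
open scoped InnerProductSpace
open Finset

section CliffordTrace

variable {ι E S : Type*} [Fintype ι] [NormedAddCommGroup E] [InnerProductSpace ℝ E]
  [AddCommGroup S] [Module ℝ S]

/-- A symmetric endomorphism can be moved across the contraction of a bilinear map over an
orthonormal basis. -/
theorem LinearMap.IsSymmetric.sum_apply_orthonormalBasis_comm {A : E →ₗ[ℝ] E}
    (hA : A.IsSymmetric) (e : OrthonormalBasis ι ℝ E) (B : E →ₗ[ℝ] E →ₗ[ℝ] S) :
    ∑ i, B (e i) (A (e i)) = ∑ i, B (A (e i)) (e i) := by
  have hexp (i : ι) : A (e i) = ∑ j, ⟪e j, A (e i)⟫_ℝ • e j := (e.sum_repr' _).symm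
  calc ∑ i, B (e i) (A (e i))
      = ∑ i, ∑ j, ⟪e j, A (e i)⟫_ℝ • B (e i) (e j) := by
        refine sum_congr rfl fun i _ => ?_
        conv_lhs => rw [hexp i]
        simp only [map_sum, map_smul]
    _ = ∑ j, ∑ i, ⟪e i, A (e j)⟫_ℝ • B (e i) (e j) := by
        rw [sum_comm]
        refine sum_congr rfl fun j _ => sum_congr rfl fun i _ => ?_
        rw [← hA, real_inner_comm]
    _ = ∑ j, B (A (e j)) (e j) := by
        refine sum_congr rfl fun j _ => ?_
        conv_rhs => rw [hexp j]
        simp only [map_sum, map_smul, LinearMap.sum_apply, LinearMap.smul_apply]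

/-- The Clifford contraction of a symmetric endomorphism is minus its trace. -/
theorem sum_clifford_mul_symmetric (e : OrthonormalBasis ι ℝ E) (c : E →ₗ[ℝ] S →ₗ[ℝ] S)
    (hclifford : ∀ v w : E, c v ∘ₗ c w + c w ∘ₗ c v = (-2 * ⟪v, w⟫_ℝ) • LinearMap.id)
    {A : E →ₗ[ℝ] E} (hA : A.IsSymmetric) (ψ : S) :
    ∑ i, c (e i) (c (A (e i)) ψ) = -(LinearMap.trace ℝ E A • ψ) := by
  have hcomm : ∑ i, c (e i) (c (A (e i)) ψ) = ∑ i, c (A (e i)) (c (e i) ψ) :=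
    hA.sum_apply_orthonormalBasis_comm e (c.compl₂ (c.flip ψ))
  have hsum : ∑ i, c (e i) (c (A (e i)) ψ) + ∑ i, c (A (e i)) (c (e i) ψ)
      = (-2 * LinearMap.trace ℝ E A) • ψ := by
    rw [← sum_add_distrib, A.trace_eq_sum_inner e, mul_sum, sum_smul]
    exact sum_congr rfl fun i _ => LinearMap.congr_fun (hclifford (e i) (A (e i))) ψ
  rw [← hcomm, ← two_smul ℝ, mul_smul, neg_smul, ← smul_neg] at hsum
  exact smul_right_injective S (two_ne_zero (α := ℝ)) hsum

end CliffordTrace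

/-- Pointwise form of the harmonicity identity `D(θ·Ψ) = −θ·DΨ − 2∇_θΨ` (equation (3)):
here `A` plays the role of `∇θ` (symmetric and trace-free since `θ` is harmonic), `ψ` of `Ψ`
and `ψ'` of `∇Ψ`. -/
theorem dirac_of_clifford_mul_harmonic
    {E S : Type*} [NormedAddCommGroup E] [InnerProductSpace ℝ E] [FiniteDimensional ℝ E]
    [NormedAddCommGroup S] [InnerProductSpace ℝ S] [FiniteDimensional ℝ S]
    (n : ℕ) (e : OrthonormalBasis (Fin n) ℝ E)
    (c : E →ₗ[ℝ] S →ₗ[ℝ] S)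
    (hclifford : ∀ v w : E, c v ∘ₗ c w + c w ∘ₗ c v = (-2 * ⟪v, w⟫_ℝ) • LinearMap.id)
    (A : E →ₗ[ℝ] E) (hA : A.IsSymmetric) (htr : LinearMap.trace ℝ E A = 0)
    (θ : E) (ψ : S) (ψ' : E →ₗ[ℝ] S)
    (Dψ' : S) (hD : Dψ' = ∑ i, c (e i) (ψ' (e i))) :
    ∑ i, c (e i) (c (A (e i)) ψ + c θ (ψ' (e i)))
      = -(c θ Dψ') - (2 : ℝ) • ψ' θ := by
  have hswap (i : Fin n) : c (e i) (c θ (ψ' (e i)))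
      = -(c θ (c (e i) (ψ' (e i)))) - (2 : ℝ) • ⟪e i, θ⟫_ℝ • ψ' (e i) := by
    have h : c (e i) (c θ (ψ' (e i))) + c θ (c (e i) (ψ' (e i)))
        = (-2 * ⟪e i, θ⟫_ℝ) • ψ' (e i) := LinearMap.congr_fun (hclifford (e i) θ) (ψ' (e i))
    rw [eq_sub_of_add_eq h]
    module
  have hθ : ∑ i, ⟪e i, θ⟫_ℝ • ψ' (e i) = ψ' θ := by
    simp only [← map_smul, ← map_sum, e.sum_repr']
  simp only [map_add, sum_add_distrib, sum_clifford_mul_symmetric e c hclifford hA, htr, hswap,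
    sum_sub_distrib, sum_neg_distrib, ← smul_sum, hθ, hD, map_sum, zero_smul, neg_zero, zero_add]
end

section
/- Let E be an n-dimensional real inner product space with n ≥ 3 and orthonormal basis (e₁,…,eₙ), S a finite-dimensional real inner product space, and c : E → (S →ₗ S) a linear map satisfying the Clifford relation c(v)∘c(w) + c(w)∘c(v) = −2⟪v,w⟫·id for all v,w ∈ E and skew-adjointness ⟪c(v)x, y⟫ = −⟪x, c(v)y⟫ for all v ∈ E, x,y ∈ S. Let ψ' : E → S be a linear map, set Dψ' := Σᵢ c(eᵢ)(ψ'(eᵢ)), let θ ∈ E with ‖θ‖ = 1, define T_X := ψ'(X) + (1/(n−1))·c(X)(Dψ') − (1/(n−1))·⟪X,θ⟫·c(θ)(Dψ') − ⟪X,θ⟫·ψ'(θ) for X ∈ E, and set u := −c(θ)(Dψ') − 2·ψ'(θ). Then Σᵢ ‖ψ'(eᵢ)‖² = Σᵢ ‖T_{eᵢ}‖² + ((n−3)/(n−1))·‖ψ'(θ)‖² + (1/(2(n−1)))·( ‖u‖² + ‖Dψ'‖² ). -/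
open scoped InnerProductSpace
open Finset

/-- Clifford multiplication by `v` scales norms by `‖v‖`. -/
theorem norm_clifford_sq {E S : Type*} [NormedAddCommGroup E] [InnerProductSpace ℝ E]
    [NormedAddCommGroup S] [InnerProductSpace ℝ S] (c : E →ₗ[ℝ] S →ₗ[ℝ] S)
    (hclifford : ∀ v w : E, c v ∘ₗ c w + c w ∘ₗ c v = (-2 * ⟪v, w⟫_ℝ) • LinearMap.id)
    (hskew : ∀ (v : E) (x y : S), ⟪c v x, y⟫_ℝ = -⟪x, c v y⟫_ℝ) (v : E) (x : S) :
    ‖c v x‖ ^ 2 = ‖v‖ ^ 2 * ‖x‖ ^ 2 := by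
  have h := congrArg (fun y => ⟪x, y⟫_ℝ) (LinearMap.congr_fun (hclifford v v) x)
  simp only [LinearMap.add_apply, LinearMap.comp_apply, LinearMap.smul_apply, LinearMap.id_apply,
    inner_add_right, real_inner_smul_right, real_inner_self_eq_norm_sq] at h
  rw [← real_inner_self_eq_norm_sq, hskew]
  linarith

/-- Expanding a linear map in an orthonormal basis, paired with a fixed vector. -/
theorem OrthonormalBasis.sum_inner_mul_inner_map {ι E S : Type*} [Fintype ι]
    [NormedAddCommGroup E] [InnerProductSpace ℝ E] [NormedAddCommGroup S] [InnerProductSpace ℝ S]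
    (e : OrthonormalBasis ι ℝ E) (f : E →ₗ[ℝ] S) (θ : E) (y : S) :
    ∑ i, ⟪e i, θ⟫_ℝ * ⟪f (e i), y⟫_ℝ = ⟪f θ, y⟫_ℝ := by
  conv_rhs => rw [← e.sum_repr' θ]
  simp [sum_inner, real_inner_smul_left]

theorem norm_add_smul_sub_smul_sq {S : Type*} [NormedAddCommGroup S] [InnerProductSpace ℝ S]
    (x y w : S) (a t : ℝ) :
    ‖x + a • y - t • w‖ ^ 2 = ‖x‖ ^ 2 + a ^ 2 * ‖y‖ ^ 2 + t ^ 2 * ‖w‖ ^ 2 + 2 * a * ⟪x, y⟫_ℝ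
      - 2 * (t * ⟪x, w⟫_ℝ) - 2 * a * (t * ⟪y, w⟫_ℝ) := by
  rw [norm_sub_sq_real, norm_add_sq_real]
  simp only [norm_smul, mul_pow, Real.norm_eq_abs, sq_abs, inner_add_left, real_inner_smul_left,
    real_inner_smul_right]
  ring

/-- Pointwise algebraic content of the integrated formula (8) of the paper, combining the
twistor-norm identity (5) and the squared-norm identity (4). -/
theorem twistor_combined_identity
    {E S : Type*} [NormedAddCommGroup E] [InnerProductSpace ℝ E]
    [NormedAddCommGroup S] [InnerProductSpace ℝ S] [FiniteDimensional ℝ S]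
    (n : ℕ) (hn : 3 ≤ n) (e : OrthonormalBasis (Fin n) ℝ E)
    (c : E →ₗ[ℝ] S →ₗ[ℝ] S)
    (hclifford : ∀ v w : E, c v ∘ₗ c w + c w ∘ₗ c v = (-2 * ⟪v, w⟫_ℝ) • LinearMap.id)
    (hskew : ∀ (v : E) (x y : S), ⟪c v x, y⟫_ℝ = -⟪x, c v y⟫_ℝ)
    (ψ' : E →ₗ[ℝ] S) (Dψ' : S) (hD : Dψ' = ∑ i, c (e i) (ψ' (e i)))
    (θ : E) (hθ : ‖θ‖ = 1)
    (T : E → S)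
    (hT : ∀ X : E, T X = ψ' X + ((n : ℝ) - 1)⁻¹ • c X Dψ'
        - (((n : ℝ) - 1)⁻¹ * ⟪X, θ⟫_ℝ) • c θ Dψ' - ⟪X, θ⟫_ℝ • ψ' θ)
    (u : S) (hu : u = -(c θ Dψ') - (2 : ℝ) • ψ' θ) :
    ∑ i, ‖ψ' (e i)‖ ^ 2
      = ∑ i, ‖T (e i)‖ ^ 2 + (((n : ℝ) - 3) / ((n : ℝ) - 1)) * ‖ψ' θ‖ ^ 2
        + (1 / (2 * ((n : ℝ) - 1))) * (‖u‖ ^ 2 + ‖Dψ'‖ ^ 2) := by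
  have hn1 : (n : ℝ) - 1 ≠ 0 := by
    have : (3 : ℝ) ≤ n := by exact_mod_cast hn
    linarith
  set a : ℝ := ((n : ℝ) - 1)⁻¹ with ha
  set w : S := a • c θ Dψ' + ψ' θ with hw
  have hTw (X : E) : T X = ψ' X + a • c X Dψ' - ⟪X, θ⟫_ℝ • w := by
    rw [hT, hw]
    module
  have hce (i : Fin n) : ‖c (e i) Dψ'‖ ^ 2 = ‖Dψ'‖ ^ 2 := by
    simp [norm_clifford_sq c hclifford hskew]
  have hcθ : ‖c θ Dψ'‖ ^ 2 = ‖Dψ'‖ ^ 2 := by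
    simp [norm_clifford_sq c hclifford hskew, hθ]
  have hsq : ∑ i, ⟪e i, θ⟫_ℝ ^ 2 = 1 := by
    simpa [hθ] using e.sum_sq_inner_right θ
  have hcross : ∑ i, ⟪ψ' (e i), c (e i) Dψ'⟫_ℝ = -‖Dψ'‖ ^ 2 := by
    have h (i : Fin n) : ⟪ψ' (e i), c (e i) Dψ'⟫_ℝ = -⟪c (e i) (ψ' (e i)), Dψ'⟫_ℝ := by
      rw [hskew, neg_neg]
    rw [sum_congr rfl fun i _ => h i, sum_neg_distrib, ← sum_inner, ← hD,
      real_inner_self_eq_norm_sq]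
  have hψ := e.sum_inner_mul_inner_map ψ' θ w
  have hc := e.sum_inner_mul_inner_map (c.flip Dψ') θ w
  simp only [LinearMap.flip_apply] at hc
  have hsum : ∑ i, ‖T (e i)‖ ^ 2 = ∑ i, ‖ψ' (e i)‖ ^ 2 + a ^ 2 * (n * ‖Dψ'‖ ^ 2) + ‖w‖ ^ 2
      - 2 * a * ‖Dψ'‖ ^ 2 - 2 * ⟪ψ' θ, w⟫_ℝ - 2 * a * ⟪c θ Dψ', w⟫_ℝ := by
    simp only [hTw, norm_add_smul_sub_smul_sq, hce, sum_add_distrib, sum_sub_distrib, ← mul_sum,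
      ← sum_mul, hsq, hcross, hψ, hc, sum_const, card_univ, Fintype.card_fin, nsmul_eq_mul]
    ring
  have hw_sq : ‖w‖ ^ 2 = a ^ 2 * ‖Dψ'‖ ^ 2 + 2 * a * ⟪c θ Dψ', ψ' θ⟫_ℝ + ‖ψ' θ‖ ^ 2 := by
    rw [hw, norm_add_sq_real, norm_smul, mul_pow, hcθ, real_inner_smul_left, Real.norm_eq_abs,
      sq_abs]
    ring
  have hψw : ⟪ψ' θ, w⟫_ℝ = a * ⟪c θ Dψ', ψ' θ⟫_ℝ + ‖ψ' θ‖ ^ 2 := by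
    rw [hw, inner_add_right, real_inner_smul_right, real_inner_self_eq_norm_sq, real_inner_comm]
  have hcw : ⟪c θ Dψ', w⟫_ℝ = a * ‖Dψ'‖ ^ 2 + ⟪c θ Dψ', ψ' θ⟫_ℝ := by
    rw [hw, inner_add_right, real_inner_smul_right, real_inner_self_eq_norm_sq, hcθ]
  have hu_sq : ‖u‖ ^ 2 = ‖Dψ'‖ ^ 2 + 4 * ⟪c θ Dψ', ψ' θ⟫_ℝ + 4 * ‖ψ' θ‖ ^ 2 := by
    rw [hu, norm_sub_sq_real, norm_neg, hcθ, inner_neg_left, real_inner_smul_right, norm_smul,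
      mul_pow, Real.norm_eq_abs, sq_abs]
    ring
  rw [hsum, hw_sq, hψw, hcw, hu_sq, ha]
  field_simp
  ring
end

section
/- Let E be an n-dimensional real inner product space with n ≥ 2 and orthonormal basis (e₁,…,eₙ), S a finite-dimensional real inner product space, and c : E → (S →ₗ S) a linear map satisfying the Clifford relation c(v)∘c(w) + c(w)∘c(v) = −2⟪v,w⟫·id for all v,w ∈ E. Let θ ∈ E with ‖θ‖ = 1, let ψ ∈ S, let λ ∈ ℝ, and let ψ' : E → S be a linear map with Σᵢ c(eᵢ)(ψ'(eᵢ)) = λ·ψ. Suppose that for every X ∈ E: ψ'(X) + (λ/(n−1))·c(X)(ψ) − (λ/(n−1))·⟪X,θ⟫·c(θ)(ψ) − ⟪X,θ⟫·ψ'(θ) = 0. Then ψ'(θ) = 0, and consequently ψ'(X) = −(λ/(n−1))·( c(X)(ψ) − ⟪X,θ⟫·c(θ)(ψ) ) for every X ∈ E. -/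
open scoped InnerProductSpace
open Finset

theorem clifford_apply_apply_self {E S : Type*} [NormedAddCommGroup E] [InnerProductSpace ℝ E]
    [AddCommGroup S] [Module ℝ S] (c : E →ₗ[ℝ] S →ₗ[ℝ] S)
    (hclifford : ∀ v w : E, c v ∘ₗ c w + c w ∘ₗ c v = (-2 * ⟪v, w⟫_ℝ) • LinearMap.id)
    {v : E} (hv : ‖v‖ = 1) (s : S) : c v (c v s) = -s := by
  have h := LinearMap.congr_fun (hclifford v v) s
  simp only [LinearMap.add_apply, LinearMap.comp_apply, LinearMap.smul_apply, LinearMap.id_apply,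
    real_inner_self_eq_norm_sq, hv] at h
  linear_combination (norm := module) (1 / 2 : ℝ) • h

/-- Contracting `⟪·, θ⟫` with a linear map over an orthonormal basis evaluates the map at `θ`. -/
theorem OrthonormalBasis.sum_inner_smul_map_apply {ι E S : Type*} [Fintype ι]
    [NormedAddCommGroup E] [InnerProductSpace ℝ E] [AddCommGroup S] [Module ℝ S]
    (e : OrthonormalBasis ι ℝ E) (c : E →ₗ[ℝ] S →ₗ[ℝ] S) (θ : E) (s : S) :
    ∑ i, ⟪e i, θ⟫_ℝ • c (e i) s = c θ s := by
  conv_rhs => rw [← e.sum_repr' θ]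
  simp

/-- Limiting case contraction argument: if the twistor-like operator vanishes on an
eigenspinor, then `∇_θΨ = 0` and `Ψ` satisfies the Killing-type equation
`∇_XΨ = −(λ/(n−1))(X·Ψ − ⟨X,θ⟩θ·Ψ)`. -/
theorem limiting_case_killing
    {E S : Type*} [NormedAddCommGroup E] [InnerProductSpace ℝ E]
    [NormedAddCommGroup S] [InnerProductSpace ℝ S] [FiniteDimensional ℝ S]
    (n : ℕ) (hn : 2 ≤ n) (e : OrthonormalBasis (Fin n) ℝ E)
    (c : E →ₗ[ℝ] S →ₗ[ℝ] S)
    (hclifford : ∀ v w : E, c v ∘ₗ c w + c w ∘ₗ c v = (-2 * ⟪v, w⟫_ℝ) • LinearMap.id)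
    (θ : E) (hθ : ‖θ‖ = 1) (ψ : S) (lam : ℝ)
    (ψ' : E →ₗ[ℝ] S) (hD : ∑ i, c (e i) (ψ' (e i)) = lam • ψ)
    (hT : ∀ X : E, ψ' X + (lam / ((n : ℝ) - 1)) • c X ψ
        - ((lam / ((n : ℝ) - 1)) * ⟪X, θ⟫_ℝ) • c θ ψ - ⟪X, θ⟫_ℝ • ψ' θ = 0) :
    ψ' θ = 0 ∧
      ∀ X : E, ψ' X = (-(lam / ((n : ℝ) - 1))) • (c X ψ - ⟪X, θ⟫_ℝ • c θ ψ) := by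
  have hn' : (n : ℝ) - 1 ≠ 0 := by
    have : (2 : ℝ) ≤ n := by exact_mod_cast hn
    linarith
  have hsum : ∑ i, c (e i) (ψ' (e i) + (lam / ((n : ℝ) - 1)) • c (e i) ψ
      - ((lam / ((n : ℝ) - 1)) * ⟪e i, θ⟫_ℝ) • c θ ψ - ⟪e i, θ⟫_ℝ • ψ' θ) = 0 := by
    simp [hT]
  simp only [map_add, map_sub, map_smul, sum_add_distrib, sum_sub_distrib, mul_smul,
    ← smul_sum, e.sum_inner_smul_map_apply, hD,
    clifford_apply_apply_self c hclifford (e.norm_eq_one _),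
    clifford_apply_apply_self c hclifford hθ, sum_const, card_univ, Fintype.card_fin,
    ← Nat.cast_smul_eq_nsmul ℝ] at hsum
  have hcoeff : lam - lam / ((n : ℝ) - 1) * n + lam / ((n : ℝ) - 1) = 0 := by
    field_simp
    ring
  have hc : c θ (ψ' θ) = 0 := by
    linear_combination (norm := module) hcoeff • ψ - hsum
  have hθ' : ψ' θ = 0 := by
    simpa [hc] using clifford_apply_apply_self c hclifford hθ (ψ' θ)
  refine ⟨hθ', fun X => ?_⟩
  have hX := hT X
  rw [hθ'] at hX
  linear_combination (norm := module) hX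
end
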